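/- arXiv:2106.00332 — 9 statements merged into one kernel-verified Lean document; each statement's English description precedes it below -/
import Mathlib

section
/- For the two-oscillator Kuramoto model with coupling strength a ≥ 0, any solution (θ₁, θ₂) satisfies |θ₁'(t) − θ₂'(t)| → 0 as t → ∞ if and only if |ω₁ − ω₂| ≤ a. -/
open Real Filter

/-- An increasing trajectory of an autonomous scalar equation that has an equilibrium above its
starting point has velocity tending to zero. -/
theorem tendsto_velocity_zero_of_pos {f u : ℝ → ℝ} (hf : Continuous f)
    (hu : ∀ t ≥ (0 : ℝ), HasDerivAt u (f (u t)) t) (hpos : ∀ t ≥ (0 : ℝ), 0 < f (u t))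
    {x : ℝ} (hx : u 0 ≤ x) (hfx : f x = 0) :
    Tendsto (fun t => f (u t)) atTop (nhds 0) := by
  have hcont : ContinuousOn u (Set.Ici 0) := fun t ht => (hu t ht).continuousAt.continuousWithinAt
  have hbound : ∀ t ≥ (0 : ℝ), u t ≤ x := by
    intro t ht
    by_contra! h
    obtain ⟨s, hs, rfl⟩ :=
      intermediate_value_Icc ht (hcont.mono Set.Icc_subset_Ici_self) ⟨hx, h.le⟩
    exact (hpos s hs.1).ne' hfx
  have hmono : MonotoneOn u (Set.Ici 0) := by
    refine (strictMonoOn_of_deriv_pos (convex_Ici 0) hcont fun t ht => ?_).monotoneOn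
    have ht' : (0 : ℝ) ≤ t := interior_subset ht
    rw [(hu t ht').deriv]
    exact hpos t ht'
  obtain ⟨L, hL⟩ : ∃ L, Tendsto u atTop (nhds L) := by
    have hm : Monotone fun t => u (max t 0) := fun s t hst =>
      hmono (le_max_right s 0) (le_max_right t 0) (max_le_max_right 0 hst)
    have hb : BddAbove (Set.range fun t => u (max t 0)) :=
      ⟨x, by rintro _ ⟨t, rfl⟩; exact hbound _ (le_max_right t 0)⟩
    refine ⟨_, (tendsto_atTop_ciSup hm hb).congr' ?_⟩
    filter_upwards [eventually_ge_atTop 0] with t ht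
    rw [max_eq_left ht]
  have hlim : Tendsto (fun t => f (u t)) atTop (nhds (f L)) := (hf.tendsto L).comp hL
  have hnonneg : 0 ≤ f L := ge_of_tendsto hlim <| by
    filter_upwards [eventually_ge_atTop 0] with t ht using (hpos t ht).le
  obtain h0 | hfL := hnonneg.eq_or_lt
  · rwa [← h0] at hlim
  · exfalso
    obtain ⟨T, hT⟩ := eventually_atTop.1 <|
      (hlim.eventually (lt_mem_nhds (half_lt_self hfL))).and (eventually_ge_atTop 0)
    have hT0 : 0 ≤ T := (hT T le_rfl).2
    have hsub : Set.Ici T ⊆ Set.Ici 0 := Set.Ici_subset_Ici.2 hT0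
    have hgrowth := (convex_Ici T).mul_sub_le_image_sub_of_le_deriv (C := f L / 2)
      (hcont.mono hsub)
      (fun t ht => (hu t (hsub (interior_subset ht))).differentiableAt.differentiableWithinAt)
      (fun t ht => by
        rw [(hu t (hsub (interior_subset ht))).deriv]
        exact (hT t (interior_subset ht)).1.le)
    have hd : 0 ≤ (x - u T + 1) / (f L / 2) :=
      div_nonneg (by linarith [hbound T hT0]) (half_pos hfL).le
    have h := hgrowth T Set.self_mem_Ici (T + (x - u T + 1) / (f L / 2))
      (le_add_of_nonneg_right hd) (le_add_of_nonneg_right hd)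
    rw [add_sub_cancel_left, mul_div_cancel₀ _ (half_pos hfL).ne'] at h
    linarith [hbound (T + (x - u T + 1) / (f L / 2)) (add_nonneg hT0 hd)]

/-- A trajectory of an autonomous scalar Lipschitz equation that starts between two equilibria has
velocity tending to zero. -/
theorem tendsto_velocity_zero {f u : ℝ → ℝ} {K : NNReal} (hf : LipschitzWith K f)
    (hu : ∀ t ≥ (0 : ℝ), HasDerivAt u (f (u t)) t)
    {x y : ℝ} (hx : x ≤ u 0) (hfx : f x = 0) (hy : u 0 ≤ y) (hfy : f y = 0) :
    Tendsto (fun t => f (u t)) atTop (nhds 0) := by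
  have hcont : ContinuousOn u (Set.Ici 0) := fun t ht => (hu t ht).continuousAt.continuousWithinAt
  by_cases hz : ∃ s ≥ (0 : ℝ), f (u s) = 0
  · obtain ⟨s, hs, hfs⟩ := hz
    refine tendsto_const_nhds.congr' ?_
    filter_upwards [eventually_ge_atTop s] with t ht
    have hconst : Set.EqOn u (fun _ => u s) (Set.Icc s t) :=
      ODE_solution_unique (v := fun _ => f) (fun _ => hf)
        (hcont.mono fun r hr => hs.trans hr.1)
        (fun r hr => (hu r (hs.trans hr.1)).hasDerivWithinAt) continuousOn_const
        (fun r _ => by simpa only [hfs] using hasDerivWithinAt_const r _ (u s)) rfl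
    rw [hconst ⟨ht, le_rfl⟩, hfs]
  · push Not at hz
    have hcomp : ContinuousOn (fun t => f (u t)) (Set.Ici 0) :=
      hf.continuous.comp_continuousOn hcont
    obtain h0 | h0 := (hz 0 le_rfl).lt_or_gt
    · have hneg : ∀ t ≥ (0 : ℝ), f (u t) < 0 := by
        intro t ht
        by_contra! h
        obtain ⟨s, hs, hfs⟩ :=
          intermediate_value_Icc ht (hcomp.mono Set.Icc_subset_Ici_self) ⟨h0.le, h⟩
        exact hz s hs.1 hfs
      have h := tendsto_velocity_zero_of_pos (f := fun z => -f (-z)) (u := fun t => -u t) (x := -x)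
        (hf.continuous.comp continuous_neg).neg
        (fun t ht => by simpa only [neg_neg] using (hu t ht).fun_neg)
        (fun t ht => by simpa only [neg_neg, neg_pos] using hneg t ht)
        (neg_le_neg hx) (by simp only [neg_neg, hfx, neg_zero])
      simpa only [neg_neg, neg_zero] using h.neg
    · refine tendsto_velocity_zero_of_pos hf.continuous hu (fun t ht => ?_) hy hfy
      by_contra! h
      obtain ⟨s, hs, hfs⟩ :=
        intermediate_value_Icc' ht (hcomp.mono Set.Icc_subset_Ici_self) ⟨h, h0.le⟩
      exact hz s hs.1 hfs

/-- **Two-oscillator Kuramoto synchronization criterion.**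
For the two-oscillator Kuramoto model
`θ₁' = ω₁ + 0.5·a·sin(θ₂ − θ₁)`, `θ₂' = ω₂ + 0.5·a·sin(θ₁ − θ₂)` with `a ≥ 0`,
any solution `(θ₁, θ₂)` satisfies `|θ₁'(t) − θ₂'(t)| → 0` as `t → ∞`
if and only if `|ω₁ − ω₂| ≤ a`. -/
theorem kuramoto_two_osc_sync_iff (ω₁ ω₂ a : ℝ) (ha : 0 ≤ a)
    (θ₁ θ₂ : ℝ → ℝ) (hθ₁ : Differentiable ℝ θ₁) (hθ₂ : Differentiable ℝ θ₂)
    (hode₁ : ∀ t ≥ (0 : ℝ), deriv θ₁ t = ω₁ + 0.5 * a * Real.sin (θ₂ t - θ₁ t))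
    (hode₂ : ∀ t ≥ (0 : ℝ), deriv θ₂ t = ω₂ + 0.5 * a * Real.sin (θ₁ t - θ₂ t)) :
    Tendsto (fun t => |deriv θ₁ t - deriv θ₂ t|) atTop (nhds 0) ↔ |ω₁ - ω₂| ≤ a := by
  have hvel : ∀ t ≥ (0 : ℝ), deriv θ₁ t - deriv θ₂ t = ω₁ - ω₂ - a * sin (θ₁ t - θ₂ t) := by
    intro t ht
    rw [hode₁ t ht, hode₂ t ht, ← neg_sub (θ₁ t) (θ₂ t), sin_neg]
    ring
  constructor
  · intro h
    suffices |ω₁ - ω₂| - a ≤ 0 by linarith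
    refine ge_of_tendsto h ?_
    filter_upwards [eventually_ge_atTop 0] with t ht
    rw [hvel t ht]
    have hsin : |a * sin (θ₁ t - θ₂ t)| ≤ a := by
      rw [abs_mul, abs_of_nonneg ha]
      exact mul_le_of_le_one_right ha (abs_sin_le_one _)
    linarith [abs_sub_abs_le_abs_sub (ω₁ - ω₂) (a * sin (θ₁ t - θ₂ t))]
  · intro h
    obtain ⟨b, hb⟩ : ∃ b, ω₁ - ω₂ = a * sin b := by
      obtain rfl | ha' := ha.eq_or_lt
      · exact ⟨0, by simpa using h⟩
      · refine ⟨arcsin ((ω₁ - ω₂) / a), ?_⟩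
        obtain ⟨h1, h2⟩ := abs_le.1 h
        rw [sin_arcsin (by rw [le_div_iff₀ ha']; linarith) (by rw [div_le_iff₀ ha']; linarith),
          mul_div_cancel₀ _ ha'.ne']
    have hlip : LipschitzWith a.toNNReal fun z => ω₁ - ω₂ - a * sin z := by
      refine LipschitzWith.of_dist_le_mul fun z w => ?_
      rw [Real.dist_eq, Real.dist_eq, coe_toNNReal a ha, sub_sub_sub_cancel_left, ← mul_sub,
        abs_mul, abs_of_nonneg ha, abs_sub_comm z w]
      exact mul_le_mul_of_nonneg_left (abs_sin_sub_sin_le w z) ha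
    have hu : ∀ t ≥ (0 : ℝ), HasDerivAt (fun t => θ₁ t - θ₂ t)
        (ω₁ - ω₂ - a * sin (θ₁ t - θ₂ t)) t := by
      intro t ht
      rw [← hvel t ht]
      exact (hθ₁ t).hasDerivAt.fun_sub (hθ₂ t).hasDerivAt
    obtain ⟨n, hn⟩ := exists_nat_ge (|θ₁ 0 - θ₂ 0 - b| / (2 * π))
    rw [div_le_iff₀ two_pi_pos] at hn
    obtain ⟨h1, h2⟩ := abs_le.1 hn
    have hlim := tendsto_velocity_zero hlip hu (x := b - n * (2 * π)) (y := b + n * (2 * π))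
      (by linarith) (by rw [sin_sub_nat_mul_two_pi, hb, sub_self])
      (by linarith) (by rw [sin_add_nat_mul_two_pi, hb, sub_self])
    refine (abs_zero (α := ℝ) ▸ hlim.abs).congr' ?_
    filter_upwards [eventually_ge_atTop 0] with t ht
    rw [hvel t ht]
end

section
/- If a > 0 and |ω₁ − ω₂| ≤ a, then every solution (θ₁, θ₂) of the two-oscillator Kuramoto model frequency-synchronizes: |θ₁'(t) − θ₂'(t)| → 0 as t → ∞. -/
open Real Filter

/-- The velocity `w - a sin x` along a solution of `x' = w - a sin x` is its initial value times a
positive factor. -/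
lemma exists_pos_mul_velocity {w a : ℝ} {x : ℝ → ℝ} (hc : Continuous x)
    (hx : ∀ t ≥ (0 : ℝ), HasDerivAt x (w - a * sin (x t)) t) {t : ℝ} (ht : 0 ≤ t) :
    ∃ c > 0, w - a * sin (x 0) = c * (w - a * sin (x t)) := by
  have hcos : Continuous fun s => cos (x s) := continuous_cos.comp hc
  let G : ℝ → ℝ := fun s => ∫ r in (0 : ℝ)..s, cos (x r)
  have hG : ∀ s, HasDerivAt G (cos (x s)) s := fun s =>
    intervalIntegral.integral_hasDerivAt_right (hcos.intervalIntegrable _ _)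
      (hcos.stronglyMeasurableAtFilter _ _) hcos.continuousAt
  have hv : ∀ s ≥ (0 : ℝ),
      HasDerivAt (fun r => exp (a * G r) * (w - a * sin (x r))) 0 s := by
    intro s hs
    have h := ((hG s).const_mul a).exp.mul (((hx s hs).sin.const_mul a).const_sub w)
    exact h.congr_deriv (by ring)
  have hconst := constant_of_has_deriv_right_zero
    (fun s hs => (hv s hs.1).continuousAt.continuousWithinAt)
    (fun s hs => (hv s hs.1).hasDerivWithinAt) t ⟨ht, le_rfl⟩
  refine ⟨exp (a * G t), exp_pos _, ?_⟩
  simpa [G] using hconst.symm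

/-- If `|w| ≤ a`, then `w - a sin` has arbitrarily large zeros. -/
lemma exists_ge_sub_mul_sin_eq_zero {w a : ℝ} (ha : 0 < a) (hw : |w| ≤ a) (b : ℝ) :
    ∃ y ≥ b, w - a * sin y = 0 := by
  obtain ⟨h₁, h₂⟩ := abs_le.mp hw
  obtain ⟨n, hn⟩ := exists_nat_ge ((b - arcsin (w / a)) / (2 * π))
  rw [div_le_iff₀ (by positivity)] at hn
  refine ⟨arcsin (w / a) + n * (2 * π), by linarith, ?_⟩
  rw [sin_add_nat_mul_two_pi, sin_arcsin (by rw [le_div_iff₀ ha]; linarith)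
    (by rw [div_le_iff₀ ha]; linarith)]
  field_simp
  ring

/-- If a function converges at infinity and its derivative converges, then the derivative converges
to zero. -/
lemma eq_zero_of_tendsto_of_tendsto_deriv {x x' : ℝ → ℝ} {l c : ℝ}
    (hx : ∀ t ≥ (0 : ℝ), HasDerivAt x (x' t) t) (hl : Tendsto x atTop (nhds l))
    (hc : Tendsto x' atTop (nhds c)) : c = 0 := by
  have hmvt : ∀ n : ℕ, ∃ s : ℝ, (n : ℝ) ≤ s ∧ x' s = x (n + 1) - x n := by
    intro n
    have hn : (0 : ℝ) ≤ n := n.cast_nonneg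
    obtain ⟨s, hs, h⟩ := exists_hasDerivAt_eq_slope x x' (lt_add_one (n : ℝ))
      (fun s hs => (hx s (hn.trans hs.1)).continuousAt.continuousWithinAt)
      (fun s hs => hx s (hn.trans hs.1.le))
    exact ⟨s, hs.1.le, by simpa using h⟩
  choose s hs hxs using hmvt
  have hs_top : Tendsto s atTop atTop := tendsto_atTop_mono hs tendsto_natCast_atTop_atTop
  have h₁ : Tendsto (fun n : ℕ => x (n + 1) - x n) atTop (nhds c) :=
    (hc.comp hs_top).congr hxs
  have h₂ : Tendsto (fun n : ℕ => x (n + 1) - x n) atTop (nhds (l - l)) :=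
    (hl.comp (tendsto_atTop_add_const_right _ 1 tendsto_natCast_atTop_atTop)).sub
      (hl.comp tendsto_natCast_atTop_atTop)
  simpa using tendsto_nhds_unique h₁ h₂

lemma tendsto_velocity_of_pos {w a : ℝ} (ha : 0 < a) (hw : |w| ≤ a) {x : ℝ → ℝ}
    (hc : Continuous x) (hx : ∀ t ≥ (0 : ℝ), HasDerivAt x (w - a * sin (x t)) t)
    (hpos : ∀ t ≥ (0 : ℝ), 0 < w - a * sin (x t)) :
    Tendsto (fun t => w - a * sin (x t)) atTop (nhds 0) := by
  have hmono : MonotoneOn x (Set.Ici 0) := by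
    refine monotoneOn_of_deriv_nonneg (convex_Ici 0) hc.continuousOn ?_ ?_ <;>
      rw [interior_Ici] <;> intro t ht
    · exact (hx t ht.le).differentiableAt.differentiableWithinAt
    · rw [(hx t ht.le).deriv]
      exact (hpos t ht.le).le
  have hmono' : Monotone fun t => x (max t 0) := fun s t hst =>
    hmono (le_max_right s 0) (le_max_right t 0) (max_le_max_right 0 hst)
  have heq : (fun t => x (max t 0)) =ᶠ[atTop] x := by
    filter_upwards [eventually_ge_atTop 0] with t ht
    rw [max_eq_left ht]
  rcases tendsto_atTop_of_monotone hmono' with h | ⟨l, h⟩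
  · obtain ⟨y, hy, hy0⟩ := exists_ge_sub_mul_sin_eq_zero ha hw (x 0)
    obtain ⟨t, hty, ht⟩ :=
      (((h.congr' heq).eventually_ge_atTop y).and (eventually_ge_atTop 0)).exists
    obtain ⟨s, hs, rfl⟩ := intermediate_value_Icc ht hc.continuousOn ⟨hy, hty⟩
    exact absurd hy0 (hpos s hs.1).ne'
  · have hl := h.congr' heq
    have hv : Tendsto (fun t => w - a * sin (x t)) atTop (nhds (w - a * sin l)) :=
      (((continuous_sin.tendsto l).comp hl).const_mul a).const_sub w
    rwa [eq_zero_of_tendsto_of_tendsto_deriv hx hl hv] at hv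

lemma tendsto_velocity {w a : ℝ} (ha : 0 < a) (hw : |w| ≤ a) {x : ℝ → ℝ}
    (hc : Continuous x) (hx : ∀ t ≥ (0 : ℝ), HasDerivAt x (w - a * sin (x t)) t) :
    Tendsto (fun t => w - a * sin (x t)) atTop (nhds 0) := by
  rcases lt_trichotomy (w - a * sin (x 0)) 0 with h | h | h
  · have hneg := tendsto_velocity_of_pos (w := -w) (x := fun t => -x t) ha (by rwa [abs_neg])
      hc.neg (fun t ht => by
        exact (hx t ht).neg.congr_deriv (by rw [sin_neg]; ring)) (fun t ht => by
        obtain ⟨c, hc0, hct⟩ := exists_pos_mul_velocity hc hx ht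
        rw [hct] at h
        have := neg_of_mul_neg_right h hc0.le
        rw [sin_neg]
        linarith)
    have := hneg.neg
    rw [neg_zero] at this
    refine this.congr fun t => ?_
    rw [sin_neg]
    ring
  · refine tendsto_const_nhds.congr' ?_
    filter_upwards [eventually_ge_atTop 0] with t ht
    obtain ⟨c, hc0, hct⟩ := exists_pos_mul_velocity hc hx ht
    rw [h] at hct
    exact ((mul_eq_zero.mp hct.symm).resolve_left hc0.ne').symm
  · refine tendsto_velocity_of_pos ha hw hc hx fun t ht => ?_
    obtain ⟨c, hc0, hct⟩ := exists_pos_mul_velocity hc hx ht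
    rw [hct] at h
    exact pos_of_mul_pos_right h hc0.le

/-- **Synchronization below the critical mismatch.**
If `a > 0` and `|ω₁ − ω₂| ≤ a`, then every solution `(θ₁, θ₂)` of the
two-oscillator Kuramoto model frequency-synchronizes:
`|θ₁'(t) − θ₂'(t)| → 0` as `t → ∞`. -/
theorem kuramoto_sync_of_small_mismatch (ω₁ ω₂ a : ℝ) (ha : 0 < a)
    (hmis : |ω₁ - ω₂| ≤ a)
    (θ₁ θ₂ : ℝ → ℝ) (hθ₁ : Differentiable ℝ θ₁) (hθ₂ : Differentiable ℝ θ₂)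
    (hode₁ : ∀ t ≥ (0 : ℝ), deriv θ₁ t = ω₁ + 0.5 * a * Real.sin (θ₂ t - θ₁ t))
    (hode₂ : ∀ t ≥ (0 : ℝ), deriv θ₂ t = ω₂ + 0.5 * a * Real.sin (θ₁ t - θ₂ t)) :
    Tendsto (fun t => |deriv θ₁ t - deriv θ₂ t|) atTop (nhds 0) := by
  have hdiff : ∀ t ≥ (0 : ℝ),
      deriv θ₁ t - deriv θ₂ t = (ω₁ - ω₂) - a * sin (θ₁ t - θ₂ t) := by
    intro t ht
    rw [hode₁ t ht, hode₂ t ht, ← neg_sub (θ₁ t), sin_neg]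
    ring
  have hv := tendsto_velocity ha hmis (hθ₁.continuous.sub hθ₂.continuous) fun t ht => by
    have h := (hθ₁ t).hasDerivAt.sub (hθ₂ t).hasDerivAt
    rwa [hdiff t ht] at h
  rw [← abs_zero]
  refine hv.abs.congr' ?_
  filter_upwards [eventually_ge_atTop 0] with t ht
  rw [hdiff t ht]
  rfl
end

section
/- If a > 0 and |ω₁ − ω₂| ≤ a, then for every solution (θ₁, θ₂) of the two-oscillator Kuramoto model, both instantaneous frequencies converge to the mean natural frequency: θ₁'(t) → (ω₁ + ω₂)/2 and θ₂'(t) → (ω₁ + ω₂)/2 as t → ∞. -/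
open Real Filter

/-- If a real function converges at infinity and so does its derivative, then the derivative
tends to `0`. -/
lemma eq_zero_of_tendsto_of_tendsto_deriv_s5 {φ v : ℝ → ℝ} {L M : ℝ}
    (hφ : ∀ t ≥ (0 : ℝ), HasDerivAt φ (v t) t)
    (hL : Tendsto φ atTop (nhds L)) (hM : Tendsto v atTop (nhds M)) : M = 0 := by
  have key : ∀ t : ℝ, ∃ ξ, t ≤ ξ ∧ (0 ≤ t → v ξ = φ (t + 1) - φ t) := by
    intro t
    by_cases ht : 0 ≤ t
    · obtain ⟨ξ, hξ, h⟩ := exists_hasDerivAt_eq_slope φ v (lt_add_one t)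
        (fun x hx => (hφ x (ht.trans hx.1)).continuousAt.continuousWithinAt)
        (fun x hx => hφ x (ht.trans hx.1.le))
      exact ⟨ξ, hξ.1.le, fun _ => by simpa using h⟩
    · exact ⟨t, le_rfl, fun h => absurd h ht⟩
  choose ξ hξ hv using key
  have h1 : Tendsto (fun t => v (ξ t)) atTop (nhds M) :=
    hM.comp (tendsto_atTop_mono hξ tendsto_id)
  have h2 : Tendsto (fun t => φ (t + 1) - φ t) atTop (nhds (L - L)) :=
    (hL.comp (tendsto_atTop_add_const_right _ 1 tendsto_id)).sub hL
  rw [sub_self] at h2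
  refine tendsto_nhds_unique (h1.congr' ?_) h2
  filter_upwards [eventually_ge_atTop 0] with t ht using hv t ht

/-- A zero of a solution of `v' = c v` with `c ≤ a` propagates forward in time. -/
lemma eq_zero_of_hasDerivAt_mul_self {v c : ℝ → ℝ} {a s : ℝ}
    (hv : ∀ t ≥ s, HasDerivAt v (c t * v t) t) (hc : ∀ t ≥ s, c t ≤ a) (h0 : v s = 0)
    {t : ℝ} (ht : s ≤ t) : v t = 0 := by
  have hd : ∀ t ≥ s, HasDerivAt (fun t => v t ^ 2 * exp (-2 * a * t))
      (2 * (c t - a) * (v t ^ 2 * exp (-2 * a * t))) t := by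
    intro t ht
    have h1 : HasDerivAt (fun t : ℝ => -2 * a * t) (-2 * a) t := by
      simpa using (hasDerivAt_id t).const_mul (-2 * a)
    refine (((hv t ht).pow 2).mul h1.exp).congr_deriv ?_
    simp only [Pi.pow_apply]
    push_cast
    ring
  have hanti : AntitoneOn (fun t => v t ^ 2 * exp (-2 * a * t)) (Set.Ici s) := by
    apply antitoneOn_of_deriv_nonpos (convex_Ici s)
    · exact fun t ht => (hd t ht).continuousAt.continuousWithinAt
    · intro t ht
      exact (hd t (interior_subset ht)).differentiableAt.differentiableWithinAt
    · intro t ht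
      rw [(hd t (interior_subset ht)).deriv]
      have := hc t (interior_subset ht)
      exact mul_nonpos_of_nonpos_of_nonneg (by linarith) (by positivity)
  have h := hanti (Set.mem_Ici.2 le_rfl) (Set.mem_Ici.2 ht) ht
  simp only [h0] at h
  have hp := exp_pos (-2 * a * t)
  have : v t ^ 2 ≤ 0 := by
    by_contra! hlt
    have := mul_pos hlt hp
    linarith
  exact pow_eq_zero_iff (two_ne_zero) |>.1 (le_antisymm this (sq_nonneg _))

/-- A solution of `φ' = Δ - a sin φ` with `|Δ| ≤ a` and nowhere vanishing derivative that
starts out increasing has `φ' → 0`. -/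
lemma tendsto_sub_mul_sin_of_pos {Δ a : ℝ} (ha : 0 < a) (hΔ : |Δ| ≤ a) {φ : ℝ → ℝ}
    (hφ : ∀ t ≥ (0 : ℝ), HasDerivAt φ (Δ - a * sin (φ t)) t)
    (hne : ∀ t ≥ (0 : ℝ), Δ - a * sin (φ t) ≠ 0) (hpos : 0 < Δ - a * sin (φ 0)) :
    Tendsto (fun t => Δ - a * sin (φ t)) atTop (nhds 0) := by
  have hcont : ContinuousOn φ (Set.Ici 0) :=
    fun t ht => (hφ t ht).continuousAt.continuousWithinAt
  have hvc : ContinuousOn (fun t => Δ - a * sin (φ t)) (Set.Ici 0) := by fun_prop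
  have hv : ∀ t ≥ (0 : ℝ), 0 < Δ - a * sin (φ t) := by
    intro t ht
    by_contra! hle
    obtain ⟨s, hs, h⟩ := intermediate_value_Icc' ht (hvc.mono Set.Icc_subset_Ici_self)
      ⟨hle, hpos.le⟩
    exact hne s hs.1 h
  have hmono : MonotoneOn φ (Set.Ici 0) := by
    apply monotoneOn_of_deriv_nonneg (convex_Ici 0) hcont
    · intro t ht
      exact (hφ t (interior_subset ht)).differentiableAt.differentiableWithinAt
    · intro t ht
      rw [(hφ t (interior_subset ht)).deriv]
      exact (hv t (interior_subset ht)).le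
  obtain ⟨B, hB0, hB⟩ : ∃ B, φ 0 ≤ B ∧ Δ - a * sin B = 0 := by
    obtain ⟨n, hn⟩ := exists_nat_ge ((φ 0 - arcsin (Δ / a)) / (2 * π))
    rw [div_le_iff₀ (by positivity)] at hn
    refine ⟨arcsin (Δ / a) + n * (2 * π), by linarith, ?_⟩
    obtain ⟨h1, h2⟩ := abs_le.1 hΔ
    rw [sin_add_nat_mul_two_pi, sin_arcsin (by rw [le_div_iff₀ ha]; linarith)
      (by rw [div_le_iff₀ ha]; linarith)]
    field_simp
    ring
  have hbd : ∀ t ≥ (0 : ℝ), φ t ≤ B := by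
    intro t ht
    by_contra! hlt
    obtain ⟨s, hs, h⟩ := intermediate_value_Icc ht (hcont.mono Set.Icc_subset_Ici_self)
      ⟨hB0, hlt.le⟩
    exact hne s hs.1 (h ▸ hB)
  obtain ⟨L, hL⟩ : ∃ L, Tendsto φ atTop (nhds L) := by
    have hm : Monotone (fun t => φ (max t 0)) := fun x y hxy =>
      hmono (Set.mem_Ici.2 (le_max_right _ _)) (Set.mem_Ici.2 (le_max_right _ _))
        (max_le_max_right 0 hxy)
    have hb : BddAbove (Set.range fun t => φ (max t 0)) :=
      ⟨B, by rintro _ ⟨t, rfl⟩; exact hbd _ (le_max_right _ _)⟩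
    refine ⟨_, (tendsto_atTop_ciSup hm hb).congr' ?_⟩
    filter_upwards [eventually_ge_atTop 0] with t ht
    rw [max_eq_left ht]
  have hM : Tendsto (fun t => Δ - a * sin (φ t)) atTop (nhds (Δ - a * sin L)) :=
    (((continuous_sin.tendsto L).comp hL).const_mul a).const_sub Δ
  rwa [eq_zero_of_tendsto_of_tendsto_deriv_s5 hφ hL hM] at hM

/-- Solutions of the phase-difference equation `φ' = Δ - a sin φ` with `|Δ| ≤ a` satisfy
`φ' → 0`. -/
lemma tendsto_sub_mul_sin {Δ a : ℝ} (ha : 0 < a) (hΔ : |Δ| ≤ a) {φ : ℝ → ℝ}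
    (hφ : ∀ t ≥ (0 : ℝ), HasDerivAt φ (Δ - a * sin (φ t)) t) :
    Tendsto (fun t => Δ - a * sin (φ t)) atTop (nhds 0) := by
  by_cases hz : ∃ s ≥ (0 : ℝ), Δ - a * sin (φ s) = 0
  · obtain ⟨s, hs, h0⟩ := hz
    refine tendsto_const_nhds.congr' ?_
    filter_upwards [eventually_ge_atTop s] with t ht
    refine (eq_zero_of_hasDerivAt_mul_self (v := fun t => Δ - a * sin (φ t))
      (c := fun t => -(a * cos (φ t))) (a := a) ?_ ?_ h0 ht).symm
    · intro t ht
      refine (((hφ t (hs.le.trans ht)).sin.const_mul a).const_sub Δ).congr_deriv ?_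
      ring
    · intro t _
      nlinarith [neg_one_le_cos (φ t)]
  · push Not at hz
    rcases (hz 0 le_rfl).lt_or_gt with h | h
    · have h' := tendsto_sub_mul_sin_of_pos (Δ := -Δ) (φ := fun t => -φ t) ha
        (by rwa [abs_neg])
        (fun t ht => by
          refine (hφ t ht).neg.congr_deriv ?_
          rw [sin_neg]
          ring)
        (fun t ht he => hz t ht (by rw [sin_neg] at he; linarith))
        (by rw [sin_neg]; linarith)
      convert h'.neg using 2
      · rw [sin_neg]
        ring
      · simp
    · exact tendsto_sub_mul_sin_of_pos ha hΔ hφ hz h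

/-- **Convergence of instantaneous frequencies to the mean frequency.**
If `a > 0` and `|ω₁ − ω₂| ≤ a`, then for every solution `(θ₁, θ₂)` of the
two-oscillator Kuramoto model, both instantaneous frequencies converge to the
mean natural frequency: `θ₁'(t) → (ω₁ + ω₂)/2` and `θ₂'(t) → (ω₁ + ω₂)/2`
as `t → ∞`. -/
theorem kuramoto_frequencies_tendsto_mean (ω₁ ω₂ a : ℝ) (ha : 0 < a)
    (hmis : |ω₁ - ω₂| ≤ a)
    (θ₁ θ₂ : ℝ → ℝ) (hθ₁ : Differentiable ℝ θ₁) (hθ₂ : Differentiable ℝ θ₂)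
    (hode₁ : ∀ t ≥ (0 : ℝ), deriv θ₁ t = ω₁ + 0.5 * a * Real.sin (θ₂ t - θ₁ t))
    (hode₂ : ∀ t ≥ (0 : ℝ), deriv θ₂ t = ω₂ + 0.5 * a * Real.sin (θ₁ t - θ₂ t)) :
    Tendsto (fun t => deriv θ₁ t) atTop (nhds ((ω₁ + ω₂) / 2)) ∧
    Tendsto (fun t => deriv θ₂ t) atTop (nhds ((ω₁ + ω₂) / 2)) := by
  have hsin (t : ℝ) : sin (θ₂ t - θ₁ t) = -sin (θ₁ t - θ₂ t) := by
    rw [← sin_neg, neg_sub]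
  have hφ : ∀ t ≥ (0 : ℝ), HasDerivAt (fun t => θ₁ t - θ₂ t)
      ((ω₁ - ω₂) - a * sin (θ₁ t - θ₂ t)) t := by
    intro t ht
    refine ((hθ₁ t).hasDerivAt.sub (hθ₂ t).hasDerivAt).congr_deriv ?_
    rw [hode₁ t ht, hode₂ t ht, hsin]
    ring
  have h := tendsto_sub_mul_sin ha hmis hφ
  constructor
  · have h1 := (h.const_mul (1 / 2)).const_add ((ω₁ + ω₂) / 2)
    rw [mul_zero, add_zero] at h1
    refine h1.congr' ?_
    filter_upwards [eventually_ge_atTop 0] with t ht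
    rw [hode₁ t ht, hsin]
    ring
  · have h1 := (h.const_mul (1 / 2)).const_sub ((ω₁ + ω₂) / 2)
    rw [mul_zero, sub_zero] at h1
    refine h1.congr' ?_
    filter_upwards [eventually_ge_atTop 0] with t ht
    rw [hode₂ t ht]
    ring
end

section
/- If a > 0 and |ω₁ − ω₂| ≤ a, then the pair defined by θ₁(t) = ((ω₁ + ω₂)/2)·t and θ₂(t) = ((ω₁ + ω₂)/2)·t + arcsin((ω₂ − ω₁)/a) is a solution of the two-oscillator Kuramoto model; in particular, a phase-locked solution (with constant phase difference and common frequency (ω₁ + ω₂)/2) exists. -/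
open Real Filter

/-- **Existence of a phase-locked solution.**
If `a > 0` and `|ω₁ − ω₂| ≤ a`, then the pair
`θ₁(t) = ((ω₁ + ω₂)/2)·t` and `θ₂(t) = ((ω₁ + ω₂)/2)·t + arcsin((ω₂ − ω₁)/a)`
is a solution of the two-oscillator Kuramoto model: both functions are
differentiable and satisfy
`θ₁' = ω₁ + 0.5·a·sin(θ₂ − θ₁)`, `θ₂' = ω₂ + 0.5·a·sin(θ₁ − θ₂)` for `t ≥ 0`.
In particular a phase-locked solution (constant phase difference, common
frequency `(ω₁ + ω₂)/2`) exists. -/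
theorem kuramoto_phase_locked_solution (ω₁ ω₂ a : ℝ) (ha : 0 < a)
    (hmis : |ω₁ - ω₂| ≤ a) :
    ∀ θ₁ θ₂ : ℝ → ℝ,
      (θ₁ = fun t => ((ω₁ + ω₂) / 2) * t) →
      (θ₂ = fun t => ((ω₁ + ω₂) / 2) * t + Real.arcsin ((ω₂ - ω₁) / a)) →
      Differentiable ℝ θ₁ ∧ Differentiable ℝ θ₂ ∧
      (∀ t ≥ (0 : ℝ), deriv θ₁ t = ω₁ + 0.5 * a * Real.sin (θ₂ t - θ₁ t)) ∧
      (∀ t ≥ (0 : ℝ), deriv θ₂ t = ω₂ + 0.5 * a * Real.sin (θ₁ t - θ₂ t)) := by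
  rintro θ₁ θ₂ rfl rfl
  have hd (c t : ℝ) : HasDerivAt (fun t => (ω₁ + ω₂) / 2 * t + c) ((ω₁ + ω₂) / 2) t := by
    simpa using ((hasDerivAt_id t).const_mul ((ω₁ + ω₂) / 2)).add_const c
  have hd₀ (t : ℝ) : HasDerivAt (fun t => (ω₁ + ω₂) / 2 * t) ((ω₁ + ω₂) / 2) t := by
    simpa using hd 0 t
  obtain ⟨h₁, h₂⟩ := abs_le.mp hmis
  have hsin : a * Real.sin (Real.arcsin ((ω₂ - ω₁) / a)) = ω₂ - ω₁ := by
    rw [Real.sin_arcsin]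
    · field_simp
    · rw [le_div_iff₀ ha]; linarith
    · rw [div_le_iff₀ ha]; linarith
  refine ⟨fun t => (hd₀ t).differentiableAt, fun t => (hd _ t).differentiableAt,
    fun t _ => ?_, fun t _ => ?_⟩
  · rw [(hd₀ t).deriv, add_sub_cancel_left, mul_assoc, hsin]
    ring
  · rw [(hd _ t).deriv, sub_add_cancel_left, Real.sin_neg, mul_assoc, mul_neg, hsin]
    ring
end

section
/- Every differentiable φ : ℝ → ℝ satisfying φ'(t) = Δω − a·sin(φ(t)) for all t ≥ 0 is monotone on [0, ∞): either φ(s) ≤ φ(t) for all 0 ≤ s ≤ t, or φ(s) ≥ φ(t) for all 0 ≤ s ≤ t. -/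
open Real

/-- A solution on `[0, ∞)` of an autonomous Lipschitz ODE that meets a zero of the vector field
is constant on `[0, ∞)`. -/
theorem eq_of_autonomous_ode_of_eq_zero {F φ : ℝ → ℝ} {K : NNReal} (hF : LipschitzWith K F)
    (hφ : ∀ t, 0 ≤ t → HasDerivAt φ (F (φ t)) t) {s t : ℝ} (hs : 0 ≤ s) (ht : 0 ≤ t)
    (h0 : F (φ s) = 0) : φ t = φ s := by
  have hconst (u : ℝ) : HasDerivAt (fun _ : ℝ => φ s) (F (φ s)) u := by
    rw [h0]
    exact hasDerivAt_const u (φ s)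
  rcases le_total s t with hst | hts
  · exact ODE_solution_unique (v := fun _ => F) (a := s) (b := t) (g := fun _ => φ s)
      (fun _ => hF)
      (fun u hu => (hφ u (hs.trans hu.1)).continuousAt.continuousWithinAt)
      (fun u hu => (hφ u (hs.trans hu.1)).hasDerivWithinAt)
      continuousOn_const (fun u _ => (hconst u).hasDerivWithinAt) rfl
      (Set.right_mem_Icc.2 hst)
  · exact ODE_solution_unique_of_mem_Icc_left (v := fun _ => F) (s := fun _ => Set.univ)
      (a := t) (b := s) (g := fun _ => φ s)
      (fun _ _ => hF.lipschitzOnWith)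
      (fun u hu => (hφ u (ht.trans hu.1)).continuousAt.continuousWithinAt)
      (fun u hu => (hφ u (ht.trans hu.1.le)).hasDerivWithinAt) (fun _ _ => trivial)
      continuousOn_const (fun u _ => (hconst u).hasDerivWithinAt) (fun _ _ => trivial) rfl
      (Set.left_mem_Icc.2 hts)

/-- A solution on `[0, ∞)` of a scalar autonomous Lipschitz ODE is monotone or antitone there. -/
theorem monotoneOn_or_antitoneOn_of_autonomous_ode {F φ : ℝ → ℝ} {K : NNReal}
    (hF : LipschitzWith K F) (hφ : ∀ t, 0 ≤ t → HasDerivAt φ (F (φ t)) t) :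
    MonotoneOn φ (Set.Ici 0) ∨ AntitoneOn φ (Set.Ici 0) := by
  have hcont : ContinuousOn φ (Set.Ici 0) :=
    fun t ht => (hφ t ht).continuousAt.continuousWithinAt
  have hsign : (∀ t, 0 ≤ t → 0 ≤ F (φ t)) ∨ ∀ t, 0 ≤ t → F (φ t) ≤ 0 := by
    by_contra! h
    obtain ⟨⟨s, hs, hs'⟩, t, ht, ht'⟩ := h
    obtain ⟨u, hu, hu'⟩ := isPreconnected_Ici.intermediate_value (Set.mem_Ici.2 hs)
      (Set.mem_Ici.2 ht) (hF.continuous.comp_continuousOn hcont)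
      (show (0 : ℝ) ∈ Set.Icc (F (φ s)) (F (φ t)) from ⟨hs'.le, ht'.le⟩)
    have hut := eq_of_autonomous_ode_of_eq_zero hF hφ hu ht hu'
    rw [hut] at ht'
    exact ht'.ne' hu'
  have hint : ∀ t ∈ interior (Set.Ici (0 : ℝ)), 0 ≤ t := fun t ht => interior_subset ht
  have hdiff : DifferentiableOn ℝ φ (interior (Set.Ici 0)) :=
    fun t ht => (hφ t (hint t ht)).differentiableAt.differentiableWithinAt
  refine hsign.imp (fun h => ?_) (fun h => ?_)
  · refine monotoneOn_of_deriv_nonneg (convex_Ici 0) hcont hdiff fun t ht => ?_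
    rw [(hφ t (hint t ht)).deriv]
    exact h t (hint t ht)
  · refine antitoneOn_of_deriv_nonpos (convex_Ici 0) hcont hdiff fun t ht => ?_
    rw [(hφ t (hint t ht)).deriv]
    exact h t (hint t ht)

/-- The right-hand side of the phase-difference equation is Lipschitz. -/
theorem lipschitzWith_sub_mul_sin (a c : ℝ) :
    LipschitzWith ‖a‖₊ fun x => c - a * Real.sin x := by
  refine lipschitzWith_of_nnnorm_deriv_le (by fun_prop) fun x => ?_
  have h : HasDerivAt (fun x => c - a * Real.sin x) (-(a * Real.cos x)) x :=
    ((Real.hasDerivAt_sin x).const_mul a).const_sub c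
  rw [h.deriv, nnnorm_neg, nnnorm_mul]
  exact mul_le_of_le_one_right zero_le (Real.abs_cos_le_one x)

/-- **Monotonicity of solutions of the phase-difference equation.**
Every differentiable `φ : ℝ → ℝ` satisfying `φ'(t) = Δω − a·sin(φ(t))` for all
`t ≥ 0` is monotone on `[0, ∞)`: either `φ(s) ≤ φ(t)` for all `0 ≤ s ≤ t`, or
`φ(s) ≥ φ(t)` for all `0 ≤ s ≤ t`. -/
theorem phase_difference_monotone (a Δω : ℝ) (φ : ℝ → ℝ)
    (hφ : Differentiable ℝ φ)
    (hode : ∀ t ≥ (0 : ℝ), deriv φ t = Δω - a * Real.sin (φ t)) :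
    (∀ s t : ℝ, 0 ≤ s → s ≤ t → φ s ≤ φ t) ∨
    (∀ s t : ℝ, 0 ≤ s → s ≤ t → φ t ≤ φ s) := by
  have h := monotoneOn_or_antitoneOn_of_autonomous_ode (lipschitzWith_sub_mul_sin a Δω)
    (fun t ht => hode t ht ▸ (hφ t).hasDerivAt)
  exact h.imp (fun h s t hs hst => h hs (hs.trans hst) hst)
    (fun h s t hs hst => h hs (hs.trans hst) hst)
end

section
/- If a > 0 and |Δω| ≤ a, then every differentiable φ : ℝ → ℝ satisfying φ'(t) = Δω − a·sin(φ(t)) for all t ≥ 0 remains bounded: |φ(t) − φ(0)| ≤ 2π for all t ≥ 0; in other words, each solution is trapped between equilibria of the phase-difference equation. -/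
open Real

/-- A solution which reaches an equilibrium stays there. -/
lemma phase_eq_of_reaches_equilibrium {a Δω c s t : ℝ} {φ : ℝ → ℝ} (ha : 0 ≤ a)
    (hφ : Differentiable ℝ φ)
    (hode : ∀ t ≥ (0 : ℝ), deriv φ t = Δω - a * Real.sin (φ t))
    (hc : a * Real.sin c = Δω) (hs : 0 ≤ s) (hst : s ≤ t) (hsc : φ s = c) : φ t = c := by
  have hzero := eq_zero_of_abs_deriv_le_mul_abs_self_of_eq_zero_right
    (f := fun x ↦ φ x - c) (f' := deriv φ) (K := a) (a := s) (b := t)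
    (by have := hφ.continuous; fun_prop)
    (fun x _ ↦ ((hφ x).hasDerivAt.sub_const c).hasDerivWithinAt) (by simp [hsc])
    (fun x hx ↦ by
      rw [hode x (hs.trans hx.1), ← hc, ← mul_sub, norm_mul, Real.norm_of_nonneg ha]
      gcongr
      rw [norm_sub_rev]
      exact Real.abs_sin_sub_sin_le (φ x) c)
  exact sub_eq_zero.mp (hzero t ⟨hst, le_rfl⟩)

/-- Under small frequency mismatch, every half-open interval of length `2π` contains an
equilibrium. -/
lemma exists_equilibrium_mem_Ico {a Δω : ℝ} (ha : 0 < a) (hmis : |Δω| ≤ a) (x : ℝ) :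
    ∃ c ∈ Set.Ico x (x + 2 * π), a * Real.sin c = Δω := by
  obtain ⟨hlo, hhi⟩ := abs_le.mp hmis
  obtain ⟨n, hn, -⟩ :=
    existsUnique_add_zsmul_mem_Ico Real.two_pi_pos (Real.arcsin (Δω / a)) x
  refine ⟨_, hn, ?_⟩
  rw [zsmul_eq_mul, Real.sin_add_int_mul_two_pi, Real.sin_arcsin, mul_div_cancel₀ _ ha.ne']
  · rwa [le_div_iff₀ ha, neg_one_mul]
  · rwa [div_le_one ha]

/-- **Boundedness of solutions of the phase-difference equation.**
If `a > 0` and `|Δω| ≤ a`, then every differentiable `φ : ℝ → ℝ` satisfying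
`φ'(t) = Δω − a·sin(φ(t))` for all `t ≥ 0` remains bounded:
`|φ(t) − φ(0)| ≤ 2π` for all `t ≥ 0`. -/
theorem phase_difference_bounded (a Δω : ℝ) (ha : 0 < a) (hmis : |Δω| ≤ a)
    (φ : ℝ → ℝ) (hφ : Differentiable ℝ φ)
    (hode : ∀ t ≥ (0 : ℝ), deriv φ t = Δω - a * Real.sin (φ t)) :
    ∀ t ≥ (0 : ℝ), |φ t - φ 0| ≤ 2 * Real.pi := by
  intro t ht
  obtain ⟨c, ⟨hc₀, hc₁⟩, hc⟩ := exists_equilibrium_mem_Ico ha hmis (φ 0)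
  have hc' : a * Real.sin (c - 2 * π) = Δω := by rwa [Real.sin_sub_two_pi]
  have hcont : ContinuousOn φ (Set.Icc 0 t) := hφ.continuous.continuousOn
  rw [abs_le]
  constructor
  · by_contra! hlt
    obtain ⟨s, hs, hsc⟩ := intermediate_value_Icc' ht hcont
      (show c - 2 * π ∈ Set.Icc (φ t) (φ 0) from ⟨by linarith, by linarith⟩)
    linarith [phase_eq_of_reaches_equilibrium ha.le hφ hode hc' hs.1 hs.2 hsc]
  · by_contra! hlt
    obtain ⟨s, hs, hsc⟩ := intermediate_value_Icc ht hcont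
      (show c ∈ Set.Icc (φ 0) (φ t) from ⟨hc₀, by linarith⟩)
    linarith [phase_eq_of_reaches_equilibrium ha.le hφ hode hc hs.1 hs.2 hsc]
end

section
/- If a > 0 and |Δω| ≤ a, then every differentiable φ : ℝ → ℝ satisfying φ'(t) = Δω − a·sin(φ(t)) for all t ≥ 0 converges to an equilibrium: there exists L ∈ ℝ such that φ(t) → L as t → ∞ and a·sin(L) = Δω. -/
open Real Filter

/-- A continuous function on a preconnected set that omits a value stays on one side of it. -/
lemma forall_lt_or_forall_gt_of_notMem_image {s : Set ℝ} (hs : IsPreconnected s) {g : ℝ → ℝ}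
    (hg : ContinuousOn g s) {y : ℝ} (hy : ∀ t ∈ s, g t ≠ y) :
    (∀ t ∈ s, y < g t) ∨ (∀ t ∈ s, g t < y) := by
  by_contra! ⟨⟨t, ht, hty⟩, ⟨u, hu, huy⟩⟩
  obtain ⟨r, hr, hry⟩ := hs.intermediate_value ht hu hg ⟨hty, huy⟩
  exact hy r hr hry

/-- A solution of an autonomous Lipschitz equation that reaches an equilibrium stays there. -/
lemma eq_of_equilibrium_of_le {f φ : ℝ → ℝ} {K : NNReal} (hf : LipschitzWith K f) {s t : ℝ}
    (hφ : ∀ t ≥ s, HasDerivAt φ (f (φ t)) t) (hs : f (φ s) = 0) (hst : s ≤ t) :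
    φ t = φ s := by
  refine ODE_solution_unique (v := fun _ => f) (g := fun _ => φ s) (fun _ => hf)
    (fun u hu => (hφ u hu.1).continuousAt.continuousWithinAt)
    (fun u hu => (hφ u hu.1).hasDerivWithinAt) continuousOn_const
    (fun u _ => ?_) rfl ⟨hst, le_rfl⟩
  simpa only [hs] using hasDerivWithinAt_const u (Set.Ici u) (φ s)

/-- The limit of a convergent solution of an autonomous equation is an equilibrium. -/
lemma equilibrium_of_tendsto {f φ : ℝ → ℝ} (hf : Continuous f)
    (hφ : ∀ t ≥ (0 : ℝ), HasDerivAt φ (f (φ t)) t) {L : ℝ} (hL : Tendsto φ atTop (nhds L)) :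
    f L = 0 := by
  have mvt : ∀ t : ℝ, ∃ ξ, t ≤ ξ ∧ (0 ≤ t → f (φ ξ) = φ (t + 1) - φ t) := by
    intro t
    by_cases ht : 0 ≤ t
    · obtain ⟨ξ, hξ, h⟩ := exists_hasDerivAt_eq_slope φ (fun u => f (φ u)) (lt_add_one t)
        (fun u hu => (hφ u (ht.trans hu.1)).continuousAt.continuousWithinAt)
        (fun u hu => hφ u (ht.trans hu.1.le))
      exact ⟨ξ, hξ.1.le, fun _ => by simpa using h⟩
    · exact ⟨t, le_rfl, fun h => absurd h ht⟩
  choose ξ hξ hslope using mvt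
  have h1 : Tendsto (fun t => f (φ (ξ t))) atTop (nhds (f L)) :=
    (hf.tendsto L).comp (hL.comp (tendsto_atTop_mono hξ tendsto_id))
  have h2 : Tendsto (fun t => φ (t + 1) - φ t) atTop (nhds 0) := by
    simpa using (hL.comp (tendsto_atTop_add_const_right atTop (1 : ℝ) tendsto_id)).sub hL
  refine tendsto_nhds_unique (h1.congr' ?_) h2
  filter_upwards [eventually_ge_atTop 0] with t ht using hslope t ht

/-- A solution of an autonomous Lipschitz equation starting between two equilibria converges. -/
lemma exists_tendsto_of_equilibria {f φ : ℝ → ℝ} {K : NNReal} (hf : LipschitzWith K f)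
    (hφ : ∀ t ≥ (0 : ℝ), HasDerivAt φ (f (φ t)) t) {p q : ℝ} (hp : f p = 0) (hq : f q = 0)
    (hp0 : p < φ 0) (hq0 : φ 0 < q) :
    ∃ L, Tendsto φ atTop (nhds L) := by
  by_cases hzero : ∃ s ≥ (0 : ℝ), f (φ s) = 0
  · obtain ⟨s, hs0, hs⟩ := hzero
    refine ⟨φ s, tendsto_const_nhds.congr' ?_⟩
    filter_upwards [eventually_ge_atTop s] with t ht
    exact (eq_of_equilibrium_of_le hf (fun u hu => hφ u (hs0.trans hu)) hs ht).symm
  push Not at hzero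
  have hcont : ContinuousOn φ (Set.Ici 0) :=
    fun t ht => (hφ t ht).continuousAt.continuousWithinAt
  have hlower : ∀ t ∈ Set.Ici (0 : ℝ), p < φ t :=
    (forall_lt_or_forall_gt_of_notMem_image isPreconnected_Ici hcont
      (fun t ht h => hzero t ht (h ▸ hp))).resolve_right
      fun h => (h 0 Set.self_mem_Ici).not_gt hp0
  have hupper : ∀ t ∈ Set.Ici (0 : ℝ), φ t < q :=
    (forall_lt_or_forall_gt_of_notMem_image isPreconnected_Ici hcont
      (fun t ht h => hzero t ht (h ▸ hq))).resolve_left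
      fun h => (h 0 Set.self_mem_Ici).not_gt hq0
  have hmax : (fun t => φ (max t 0)) =ᶠ[atTop] φ := by
    filter_upwards [eventually_ge_atTop 0] with t ht
    rw [max_eq_left ht]
  have hderiv : ∀ t ∈ interior (Set.Ici (0 : ℝ)),
      HasDerivWithinAt φ (f (φ t)) (interior (Set.Ici 0)) t :=
    fun t ht => (hφ t (interior_subset ht)).hasDerivWithinAt
  rcases forall_lt_or_forall_gt_of_notMem_image isPreconnected_Ici
    (hf.continuous.comp_continuousOn hcont) hzero with hpos | hneg
  · have hmono : MonotoneOn φ (Set.Ici 0) :=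
      monotoneOn_of_hasDerivWithinAt_nonneg (convex_Ici 0) hcont hderiv
        fun t ht => (hpos t (interior_subset ht)).le
    refine ⟨_, (tendsto_atTop_ciSup (f := fun t => φ (max t 0)) (fun t u htu => ?_)
      ⟨q, ?_⟩).congr' hmax⟩
    · exact hmono (le_max_right t 0) (le_max_right u 0) (max_le_max_right 0 htu)
    · rintro _ ⟨t, rfl⟩
      exact (hupper _ (le_max_right t 0)).le
  · have hanti : AntitoneOn φ (Set.Ici 0) :=
      antitoneOn_of_hasDerivWithinAt_nonpos (convex_Ici 0) hcont hderiv
        fun t ht => (hneg t (interior_subset ht)).le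
    refine ⟨_, (tendsto_atTop_ciInf (f := fun t => φ (max t 0)) (fun t u htu => ?_)
      ⟨p, ?_⟩).congr' hmax⟩
    · exact hanti (le_max_right t 0) (le_max_right u 0) (max_le_max_right 0 htu)
    · rintro _ ⟨t, rfl⟩
      exact (hlower _ (le_max_right t 0)).le

lemma lipschitzWith_const_sub_mul_sin (a c : ℝ) :
    LipschitzWith ‖a‖₊ (fun x => c - a * Real.sin x) := by
  refine lipschitzWith_of_nnnorm_deriv_le (by fun_prop) fun x => ?_
  have h : HasDerivAt (fun x => c - a * Real.sin x) (-(a * Real.cos x)) x :=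
    ((Real.hasDerivAt_sin x).const_mul a).const_sub c
  rw [h.deriv, nnnorm_neg, nnnorm_mul]
  exact mul_le_of_le_one_right' (Real.abs_cos_le_one x)

/-- **Convergence of solutions of the phase-difference equation to an equilibrium.**
If `a > 0` and `|Δω| ≤ a`, then every differentiable `φ : ℝ → ℝ` satisfying
`φ'(t) = Δω − a·sin(φ(t))` for all `t ≥ 0` converges to an equilibrium:
there exists `L ∈ ℝ` with `φ(t) → L` as `t → ∞` and `a·sin(L) = Δω`. -/
theorem phase_difference_tendsto_equilibrium (a Δω : ℝ) (ha : 0 < a)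
    (hmis : |Δω| ≤ a)
    (φ : ℝ → ℝ) (hφ : Differentiable ℝ φ)
    (hode : ∀ t ≥ (0 : ℝ), deriv φ t = Δω - a * Real.sin (φ t)) :
    ∃ L : ℝ, Tendsto φ atTop (nhds L) ∧ a * Real.sin L = Δω := by
  have hf := lipschitzWith_const_sub_mul_sin a Δω
  have hsol : ∀ t ≥ (0 : ℝ), HasDerivAt φ (Δω - a * Real.sin (φ t)) t :=
    fun t ht => hode t ht ▸ (hφ t).hasDerivAt
  obtain ⟨hlo, hhi⟩ := abs_le.1 hmis
  have hzero : ∀ n : ℤ, Δω - a * Real.sin (Real.arcsin (Δω / a) + n * (2 * π)) = 0 := by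
    intro n
    rw [Real.sin_add_int_mul_two_pi, Real.sin_arcsin ((le_div_iff₀ ha).2 (by linarith))
      ((div_le_one ha).2 hhi), mul_div_cancel₀ _ ha.ne', sub_self]
  obtain ⟨m, hm⟩ := exists_int_lt ((φ 0 - Real.arcsin (Δω / a)) / (2 * π))
  obtain ⟨n, hn⟩ := exists_int_gt ((φ 0 - Real.arcsin (Δω / a)) / (2 * π))
  rw [lt_div_iff₀ Real.two_pi_pos] at hm
  rw [div_lt_iff₀ Real.two_pi_pos] at hn
  obtain ⟨L, hL⟩ := exists_tendsto_of_equilibria hf hsol (hzero m) (hzero n)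
    (by linarith) (by linarith)
  exact ⟨L, hL, (sub_eq_zero.1 (equilibrium_of_tendsto hf.continuous hsol hL)).symm⟩
end

section
/- If a > 0 and |Δω| ≤ a, then for every differentiable φ : ℝ → ℝ satisfying φ'(t) = Δω − a·sin(φ(t)) for all t ≥ 0, one has sin(φ(t)) → Δω/a as t → ∞. -/
open Real Filter

/-- Along a solution, the sign of the velocity is preserved: the velocity is the initial velocity
times a positive factor. -/
lemma velocity_eq_mul_exp (a ω : ℝ) (φ : ℝ → ℝ) (hφ : Differentiable ℝ φ)
    (hode : ∀ t ≥ (0 : ℝ), deriv φ t = ω - a * Real.sin (φ t)) {t : ℝ} (ht : 0 ≤ t) :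
    ω - a * Real.sin (φ t) =
      (ω - a * Real.sin (φ 0)) * Real.exp (-∫ s in (0 : ℝ)..t, a * Real.cos (φ s)) := by
  have hcont : Continuous fun s => a * Real.cos (φ s) := by
    have := hφ.continuous
    fun_prop
  set I : ℝ → ℝ := fun t => ∫ s in (0 : ℝ)..t, a * Real.cos (φ s) with hI
  have hI' : ∀ s, HasDerivAt I (a * Real.cos (φ s)) s := fun s =>
    hcont.integral_hasStrictDerivAt 0 s |>.hasDerivAt
  have hderiv : ∀ s, 0 ≤ s →
      HasDerivAt (fun s => (ω - a * Real.sin (φ s)) * Real.exp (I s)) 0 s := by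
    intro s hs
    have h1 : HasDerivAt φ (ω - a * Real.sin (φ s)) s := hode s hs ▸ (hφ s).hasDerivAt
    refine (((h1.sin.const_mul a).const_sub ω).mul (hI' s).exp).congr_deriv ?_
    ring
  have hconst := constant_of_has_deriv_right_zero (a := 0) (b := t)
    (fun s hs => (hderiv s hs.1).continuousAt.continuousWithinAt)
    (fun s hs => (hderiv s hs.1).hasDerivWithinAt) t ⟨ht, le_rfl⟩
  have hI0 : I 0 = 0 := by simp [hI]
  simp only [hI0, Real.exp_zero, mul_one] at hconst
  rw [← hconst, mul_assoc, ← Real.exp_add]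
  simp [hI]

/-- If `φ` converges at infinity and its derivative is eventually `f ∘ φ` with `f` continuous, then
the limit is a zero of `f`. -/
lemma eq_zero_of_tendsto_of_deriv_eq {f φ : ℝ → ℝ} (hf : Continuous f)
    (hφ : Differentiable ℝ φ) (hode : ∀ t ≥ (0 : ℝ), deriv φ t = f (φ t)) {L : ℝ}
    (hL : Tendsto φ atTop (nhds L)) : f L = 0 := by
  have hmvt : ∀ t : ℝ, ∃ ξ ∈ Set.Ioo t (t + 1), deriv φ ξ = φ (t + 1) - φ t := by
    intro t
    obtain ⟨ξ, hξ, h⟩ := exists_deriv_eq_slope φ (lt_add_one t) hφ.continuous.continuousOn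
      hφ.differentiableOn
    exact ⟨ξ, hξ, by simpa using h⟩
  choose ξ hξ hslope using hmvt
  have hξtop : Tendsto ξ atTop atTop := tendsto_atTop_mono (fun t => (hξ t).1.le) tendsto_id
  have h1 : Tendsto (fun t => f (φ (ξ t))) atTop (nhds (f L)) :=
    (hf.tendsto L).comp (hL.comp hξtop)
  have h2 : Tendsto (fun t => φ (t + 1) - φ t) atTop (nhds (L - L)) :=
    (hL.comp (tendsto_atTop_add_const_right atTop 1 tendsto_id)).sub hL
  rw [sub_self] at h2
  refine tendsto_nhds_unique (h1.congr' ?_) h2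
  filter_upwards [eventually_ge_atTop 0] with t ht
  rw [← hslope, hode _ (ht.trans (hξ t).1.le)]

/-- Convergence of `sin ∘ φ` when the initial velocity is nonnegative. -/
lemma sin_tendsto_of_initial_velocity_nonneg (a ω : ℝ) (ha : 0 < a) (hmis : |ω| ≤ a)
    (φ : ℝ → ℝ) (hφ : Differentiable ℝ φ)
    (hode : ∀ t ≥ (0 : ℝ), deriv φ t = ω - a * Real.sin (φ t))
    (h0 : 0 ≤ ω - a * Real.sin (φ 0)) :
    Tendsto (fun t => Real.sin (φ t)) atTop (nhds (ω / a)) := by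
  have hvel := fun t (ht : 0 ≤ t) => velocity_eq_mul_exp a ω φ hφ hode ht
  rcases h0.eq_or_lt with h0 | h0
  · refine tendsto_const_nhds.congr' ?_
    filter_upwards [eventually_ge_atTop 0] with t ht
    have := hvel t ht
    rw [← h0, zero_mul] at this
    rw [div_eq_iff ha.ne']
    linarith
  have hpos : ∀ t, 0 ≤ t → 0 < ω - a * Real.sin (φ t) := fun t ht => by
    rw [hvel t ht]
    positivity
  have hmono : MonotoneOn φ (Set.Ici 0) := by
    refine monotoneOn_of_deriv_nonneg (convex_Ici 0) hφ.continuous.continuousOn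
      hφ.differentiableOn fun t ht => ?_
    have ht' : 0 ≤ t := interior_subset ht
    rw [hode t ht']
    exact (hpos t ht').le
  obtain ⟨hlo, hhi⟩ := abs_le.1 hmis
  obtain ⟨n, hn⟩ := Archimedean.arch (φ 0 - Real.arcsin (ω / a)) Real.two_pi_pos
  set c := Real.arcsin (ω / a) + n * (2 * π) with hc
  have hsinc : a * Real.sin c = ω := by
    rw [hc, Real.sin_add_nat_mul_two_pi, Real.sin_arcsin (by rw [le_div_iff₀ ha]; linarith)
      (by rw [div_le_iff₀ ha]; linarith)]
    field_simp
  have h0c : φ 0 ≤ c := by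
    rw [nsmul_eq_mul] at hn
    linarith
  have hbdd : ∀ t, 0 ≤ t → φ t ≤ c := by
    intro t ht
    by_contra! hlt
    obtain ⟨s, hs, hsc⟩ := intermediate_value_Icc ht hφ.continuous.continuousOn ⟨h0c, hlt.le⟩
    have := hpos s hs.1
    rw [hsc, hsinc] at this
    linarith
  have hmono' : Monotone fun t => φ (max t 0) := fun s t hst =>
    hmono (le_max_right s 0) (le_max_right t 0) (max_le_max_right 0 hst)
  obtain ⟨L, hL'⟩ : ∃ L, Tendsto (fun t => φ (max t 0)) atTop (nhds L) :=
    ⟨_, tendsto_atTop_ciSup hmono' ⟨c, by rintro _ ⟨t, rfl⟩; exact hbdd _ (le_max_right t 0)⟩⟩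
  have hL : Tendsto φ atTop (nhds L) := by
    refine hL'.congr' ?_
    filter_upwards [eventually_ge_atTop 0] with t ht
    rw [max_eq_left ht]
  have hzero := eq_zero_of_tendsto_of_deriv_eq (f := fun x => ω - a * Real.sin x)
    (by fun_prop) hφ hode hL
  have hsinL : ω / a = Real.sin L := by
    rw [div_eq_iff ha.ne']
    linarith
  rw [hsinL]
  exact (Real.continuous_sin.tendsto L).comp hL

/-- **Asymptotics of `sin ∘ φ` for the phase-difference equation.**
If `a > 0` and `|Δω| ≤ a`, then for every differentiable `φ : ℝ → ℝ`
satisfying `φ'(t) = Δω − a·sin(φ(t))` for all `t ≥ 0`, one has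
`sin(φ(t)) → Δω/a` as `t → ∞`. -/
theorem phase_difference_sin_tendsto (a Δω : ℝ) (ha : 0 < a) (hmis : |Δω| ≤ a)
    (φ : ℝ → ℝ) (hφ : Differentiable ℝ φ)
    (hode : ∀ t ≥ (0 : ℝ), deriv φ t = Δω - a * Real.sin (φ t)) :
    Tendsto (fun t => Real.sin (φ t)) atTop (nhds (Δω / a)) := by
  rcases le_total 0 (Δω - a * Real.sin (φ 0)) with h0 | h0
  · exact sin_tendsto_of_initial_velocity_nonneg a Δω ha hmis φ hφ hode h0
  · have h := sin_tendsto_of_initial_velocity_nonneg a (-Δω) ha (by rwa [abs_neg])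
      (fun t => -φ t) hφ.neg
      (fun t ht => by
        rw [deriv.fun_neg, hode t ht, Real.sin_neg]
        ring)
      (by
        rw [Real.sin_neg]
        linarith)
    simpa [neg_div] using h.neg
end

section
/- Let A be a nonempty finite uncertainty class with probability weights p : A → ℝ, p(a) ≥ 0, Σ_{a∈A} p(a) = 1, and cost function ξ : A → ℝ. Let A = A₀ ⊔ A₁ be a partition into two disjoint nonempty subsets (the two possible outcomes of a binary experiment), with outcome probabilities P(o) = Σ_{a∈A_o} p(a) assumed strictly positive, and conditional MOCU M(A | o) = Σ_{a∈A_o} (p(a)/P(o))·(max_{a'∈A_o} ξ(a') − ξ(a)) for o ∈ {0, 1}. Then the expected remaining MOCU never exceeds the MOCU: P(0)·M(A | 0) + P(1)·M(A | 1) ≤ M(A). -/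
open Finset

/-- The conditional MOCU of a subclass, weighted by the probability of the subclass, is at most
the contribution of that subclass to the MOCU of the full class. -/
theorem sum_mul_conditional_mocu_le {A : Type*} [Fintype A] [Nonempty A]
    (p ξ : A → ℝ) (hp : ∀ a, 0 ≤ p a) (s : Finset A) (hs : s.Nonempty)
    (hP : 0 < ∑ a ∈ s, p a) :
    (∑ a ∈ s, p a) * (∑ a ∈ s, (p a / ∑ b ∈ s, p b) * (s.sup' hs ξ - ξ a)) ≤
      ∑ a ∈ s, p a * (Finset.univ.sup' Finset.univ_nonempty ξ - ξ a) := by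
  rw [Finset.mul_sum]
  refine Finset.sum_le_sum fun a _ => ?_
  rw [← mul_assoc, mul_div_cancel₀ _ hP.ne']
  exact mul_le_mul_of_nonneg_left
    (sub_le_sub_right (Finset.sup'_mono ξ (Finset.subset_univ s) hs) _) (hp a)

/-- **Experiments never increase the MOCU in expectation.**
Let `A` be a nonempty finite uncertainty class with probability weights `p`
(`p a ≥ 0`, `Σ p a = 1`) and cost `ξ : A → ℝ`. Let `A = A₀ ⊔ A₁` be a
partition into two disjoint nonempty subsets (the outcomes of a binary
experiment), with strictly positive outcome probabilities
`P(o) = Σ_{a ∈ A_o} p(a)`, and conditional MOCU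
`M(A | o) = Σ_{a ∈ A_o} (p(a)/P(o))·(max_{a' ∈ A_o} ξ(a') − ξ(a))`.
Then the expected remaining MOCU never exceeds the MOCU:
`P(0)·M(A | 0) + P(1)·M(A | 1) ≤ M(A)`. -/
theorem expected_remaining_mocu_le_mocu {A : Type*} [Fintype A] [Nonempty A] [DecidableEq A]
    (p ξ : A → ℝ) (hp : ∀ a, 0 ≤ p a) (hsum : ∑ a, p a = 1)
    (A₀ A₁ : Finset A) (h0 : A₀.Nonempty) (h1 : A₁.Nonempty)
    (hdisj : Disjoint A₀ A₁) (hunion : A₀ ∪ A₁ = Finset.univ)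
    (hP0 : 0 < ∑ a ∈ A₀, p a) (hP1 : 0 < ∑ a ∈ A₁, p a) :
    (∑ a ∈ A₀, p a) * (∑ a ∈ A₀, (p a / ∑ b ∈ A₀, p b) * (A₀.sup' h0 ξ - ξ a)) +
      (∑ a ∈ A₁, p a) * (∑ a ∈ A₁, (p a / ∑ b ∈ A₁, p b) * (A₁.sup' h1 ξ - ξ a)) ≤
      ∑ a, p a * (Finset.univ.sup' Finset.univ_nonempty ξ - ξ a) := by
  calc
    _ ≤ _ := add_le_add (sum_mul_conditional_mocu_le p ξ hp A₀ h0 hP0)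
      (sum_mul_conditional_mocu_le p ξ hp A₁ h1 hP1)
    _ = _ := by rw [← Finset.sum_union hdisj, hunion]
end
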